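/- Let r be an odd positive integer, let f : ℝ → ℝ be of class C^{r+1}, and suppose f^{(r+1)} is nonnegative on [a, b] (with a < b) and {x ∈ [a, b] : f^{(r+1)}(x) = 0} is finite. Then for any point P = (s, t) in the plane, at most two distinct Taylor polynomials of order r of f centered at points of [a, b] pass through P; that is, there do not exist a ≤ c₁ < c₂ < c₃ ≤ b such that the three functions P_{c₁}, P_{c₂}, P_{c₃} are pairwise distinct and all satisfy P_{cᵢ}(s) = t. -/

import Mathlib

/-- The Taylor polynomial of order `r` of `f` centered at `c`, as a function on `ℝ`. -/
noncomputable def taylorPoly (f : ℝ → ℝ) (r : ℕ) (c : ℝ) : ℝ → ℝ :=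
  fun x => ∑ k ∈ Finset.range (r + 1), iteratedDeriv k f c / (k.factorial : ℝ) * (x - c) ^ k

theorem taylorPoly_eq_taylorWithinEval (f : ℝ → ℝ) (r : ℕ) (c x : ℝ) :
    taylorPoly f r c x = taylorWithinEval f r Set.univ c x := by
  rw [taylor_within_apply, taylorPoly]
  refine Finset.sum_congr rfl fun k _ => ?_
  rw [iteratedDerivWithin_univ, smul_eq_mul]
  ring

/-- The derivative of the Taylor polynomial with respect to its center. -/
theorem hasDerivAt_taylorPoly_center {f : ℝ → ℝ} {r : ℕ} (hf : ContDiff ℝ (r + 1 : ℕ) f)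
    (s c : ℝ) :
    HasDerivAt (fun y => taylorPoly f r y s)
      ((r.factorial : ℝ)⁻¹ * (s - c) ^ r * iteratedDeriv (r + 1) f c) c := by
  have hdiff : Differentiable ℝ (iteratedDeriv r f) :=
    hf.differentiable_iteratedDeriv r (by exact_mod_cast Nat.lt_succ_self r)
  have h := hasDerivWithinAt_taylorWithinEval (f := f) (x := s) (y := c) (n := r)
    uniqueDiffOn_univ Filter.univ_mem (Set.mem_univ c) subset_rfl
    (hf.of_le (by exact_mod_cast Nat.le_succ r)).contDiffOn
    (by rw [iteratedDerivWithin_univ]; exact (hdiff c).differentiableWithinAt)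
  simpa only [taylorPoly_eq_taylorWithinEval, iteratedDerivWithin_univ, smul_eq_mul,
    hasDerivWithinAt_univ] using h

/-- A function with nonnegative derivative and equal values at the endpoints of an interval
has zero derivative inside. -/
theorem deriv_eq_zero_of_nonneg_of_eq_endpoints {g g' : ℝ → ℝ} {u v : ℝ}
    (hg : ∀ x, HasDerivAt g (g' x) x) (hg' : ∀ x ∈ Set.Icc u v, 0 ≤ g' x) (huv : g u = g v)
    {x : ℝ} (hx : x ∈ Set.Ioo u v) : g' x = 0 := by
  have hmono : MonotoneOn g (Set.Icc u v) :=
    monotoneOn_of_hasDerivWithinAt_nonneg (convex_Icc u v)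
      (fun y _ => (hg y).continuousAt.continuousWithinAt)
      (fun y _ => (hg y).hasDerivWithinAt) (fun y hy => hg' y (interior_subset hy))
  have hle : u ≤ v := (hx.1.trans hx.2).le
  have hconst : ∀ y ∈ Set.Icc u v, g y = g u := fun y hy =>
    le_antisymm ((hmono hy (Set.right_mem_Icc.2 hle) hy.2).trans_eq huv.symm)
      (hmono (Set.left_mem_Icc.2 hle) hy hy.1)
  refine (hg x).unique ((hasDerivAt_const x (g u)).congr_of_eventuallyEq ?_)
  filter_upwards [Icc_mem_nhds hx.1 hx.2] with y hy using hconst y hy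

/-- If the Taylor polynomials of odd order at two centers agree at `s`, then `s` lies strictly
between the centers. -/
theorem mem_Ioo_of_taylorPoly_eq {f : ℝ → ℝ} {r : ℕ} (hr : Odd r)
    (hf : ContDiff ℝ (r + 1 : ℕ) f) {u v s : ℝ} (huv : u < v)
    (hnonneg : ∀ x ∈ Set.Icc u v, 0 ≤ iteratedDeriv (r + 1) f x)
    (hfin : {x ∈ Set.Icc u v | iteratedDeriv (r + 1) f x = 0}.Finite)
    (heq : taylorPoly f r u s = taylorPoly f r v s) : s ∈ Set.Ioo u v := by
  have hfact : (0 : ℝ) < (r.factorial : ℝ)⁻¹ := by positivity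
  by_contra hs
  have hne : ∀ x ∈ Set.Ioo u v, s - x ≠ 0 := fun x hx h0 => hs (by rwa [sub_eq_zero.1 h0])
  have hzero : ∀ x ∈ Set.Ioo u v,
      (r.factorial : ℝ)⁻¹ * (s - x) ^ r * iteratedDeriv (r + 1) f x = 0 := by
    intro x hx
    rcases le_or_gt s u with hsu | hsu
    · refine neg_eq_zero.1 (deriv_eq_zero_of_nonneg_of_eq_endpoints
        (fun y => (hasDerivAt_taylorPoly_center hf s y).neg) (fun y hy => ?_)
        (congrArg Neg.neg heq) hx)
      exact neg_nonneg.2 (mul_nonpos_of_nonpos_of_nonneg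
        (mul_nonpos_of_nonneg_of_nonpos hfact.le
          (hr.pow_nonpos_iff.2 (sub_nonpos.2 (hsu.trans hy.1)))) (hnonneg y hy))
    · have hvs : v ≤ s := not_lt.1 fun h => hs ⟨hsu, h⟩
      exact deriv_eq_zero_of_nonneg_of_eq_endpoints (hasDerivAt_taylorPoly_center hf s)
        (fun y hy => mul_nonneg (mul_nonneg hfact.le
          (pow_nonneg (sub_nonneg.2 (hy.2.trans hvs)) r)) (hnonneg y hy)) heq hx
  refine Set.Ioo_infinite huv (hfin.subset fun x hx => ⟨Set.Ioo_subset_Icc_self hx, ?_⟩)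
  exact (mul_eq_zero.1 (hzero x hx)).resolve_left
    (mul_ne_zero hfact.ne' (pow_ne_zero r (hne x hx)))

/-- **Lemma (Horwitz, Section 3).** Let `r` be an odd positive integer and `f ∈ C^{r+1}`.
If `f^{(r+1)}` is nonnegative on `[a, b]` with finitely many zeros there, then at most two
distinct Taylor polynomials of order `r` centered at points of `[a, b]` can pass through
any given point `(s, t)` of the plane. -/
theorem at_most_two_taylor_polys_through_point
    (r : ℕ) (hr : Odd r) (hrpos : 0 < r)
    (f : ℝ → ℝ) (hf : ContDiff ℝ (r + 1 : ℕ) f)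
    (a b : ℝ) (hab : a < b)
    (hnonneg : ∀ x ∈ Set.Icc a b, 0 ≤ iteratedDeriv (r + 1) f x)
    (hfin : {x ∈ Set.Icc a b | iteratedDeriv (r + 1) f x = 0}.Finite)
    (s t : ℝ) :
    ¬ ∃ c₁ c₂ c₃ : ℝ, a ≤ c₁ ∧ c₁ < c₂ ∧ c₂ < c₃ ∧ c₃ ≤ b ∧
      taylorPoly f r c₁ ≠ taylorPoly f r c₂ ∧
      taylorPoly f r c₁ ≠ taylorPoly f r c₃ ∧
      taylorPoly f r c₂ ≠ taylorPoly f r c₃ ∧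
      taylorPoly f r c₁ s = t ∧ taylorPoly f r c₂ s = t ∧ taylorPoly f r c₃ s = t := by
  rintro ⟨c₁, c₂, c₃, ha, h₁₂, h₂₃, hb, -, -, -, h₁, h₂, h₃⟩
  have hbetween : ∀ {u v : ℝ}, a ≤ u → u < v → v ≤ b →
      taylorPoly f r u s = taylorPoly f r v s → s ∈ Set.Ioo u v := fun hau huv hvb heq =>
    mem_Ioo_of_taylorPoly_eq hr hf huv
      (fun x hx => hnonneg x (Set.Icc_subset_Icc hau hvb hx))
      (hfin.subset fun x hx => ⟨Set.Icc_subset_Icc hau hvb hx.1, hx.2⟩) heq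
  exact lt_asymm (hbetween ha h₁₂ (h₂₃.le.trans hb) (h₁.trans h₂.symm)).2
    (hbetween (ha.trans h₁₂.le) h₂₃ hb (h₂.trans h₃.symm)).1
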